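/- Let α ∈ (1,2] and let γ be a probability measure on [1,∞) that is a fixed point of the α-recursive distributional equation. Then there exists a constant D ∈ [1,2] such that γ([t,∞)) = D/t + 1 − D for every t ∈ [1,2]; moreover D = 2 − ∫₂^∞ (Σ_{k=2}^∞ θ_α(k)·γ^{⊗k}({(s₁,…,s_k) : s₁+⋯+s_k ≥ x})) · (x−1)^{−2} dx. -/

import Mathlib

open MeasureTheory

/-- The α-offspring distribution: θ_α(k) = α(2−α)(3−α)⋯(k−1−α)/k! for k ≥ 2, and 0 else. -/
noncomputable def thetaDist (α : ℝ) (k : ℕ) : ℝ :=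
  if 2 ≤ k then α * (∏ i ∈ Finset.Icc 2 (k - 1), ((i : ℝ) - α)) / (Nat.factorial k : ℝ) else 0

/-- The uniform distribution on [0,1]. -/
noncomputable def unifMeasure : Measure ℝ := volume.restrict (Set.Icc 0 1)

/-- The map on measures associated with the α-recursive distributional equation:
the law of G(U,N,(X₁,…,X_N)) = (U + (1−U)/(X₁+⋯+X_N))⁻¹ where U is uniform on [0,1],
N ~ θ_α and the X_i are i.i.d. with law γ, all independent (decomposed according to
the value of N). -/
noncomputable def rdeMap (α : ℝ) (γ : Measure ℝ) : Measure ℝ :=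
  Measure.sum fun k : ℕ =>
    ENNReal.ofReal (thetaDist α k) •
      Measure.map (fun p : ℝ × (Fin k → ℝ) => (p.1 + (1 - p.1) / ∑ i, p.2 i)⁻¹)
        (unifMeasure.prod (Measure.pi fun _ : Fin k => γ))

/-- γ is a probability measure on [1,∞) that is a fixed point of the α-recursive
distributional equation. -/
def IsRDEFixedPoint (α : ℝ) (γ : Measure ℝ) : Prop :=
  IsProbabilityMeasure γ ∧ γ (Set.Iio 1) = 0 ∧ rdeMap α γ = γ

theorem thetaDist_nonneg {α : ℝ} (hα : α ∈ Set.Ioc (1 : ℝ) 2) (k : ℕ) : 0 ≤ thetaDist α k := by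
  unfold thetaDist
  split_ifs with hk
  · have hprod : 0 ≤ ∏ i ∈ Finset.Icc 2 (k - 1), ((i : ℝ) - α) := by
      refine Finset.prod_nonneg fun i hi => ?_
      have h2 : (2 : ℝ) ≤ i := by exact_mod_cast (Finset.mem_Icc.mp hi).1
      linarith [hα.2]
    have hα0 : 0 ≤ α := by linarith [hα.1]
    positivity
  · exact le_rfl

/-- The law of X₁ + ⋯ + X_N, where N ~ θ_α and the X_i are i.i.d. with law γ. -/
noncomputable def offspringSumLaw (α : ℝ) (γ : Measure ℝ) : Measure ℝ :=
  Measure.sum fun k : ℕ =>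
    ENNReal.ofReal (thetaDist α k) •
      Measure.map (fun s : Fin k → ℝ => ∑ i, s i) (Measure.pi fun _ : Fin k => γ)

theorem measurable_coordSum (k : ℕ) : Measurable fun s : Fin k → ℝ => ∑ i, s i := by
  fun_prop

theorem measurable_rdeFun (k : ℕ) :
    Measurable fun p : ℝ × (Fin k → ℝ) => (p.1 + (1 - p.1) / ∑ i, p.2 i)⁻¹ := by
  fun_prop

theorem isProbabilityMeasure_unifMeasure : IsProbabilityMeasure unifMeasure :=
  ⟨by simp [unifMeasure]⟩

theorem offspringSumLaw_apply (α : ℝ) (γ : Measure ℝ) {A : Set ℝ} (hA : MeasurableSet A) :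
    offspringSumLaw α γ A = ∑' k : ℕ, ENNReal.ofReal (thetaDist α k) *
      (Measure.pi fun _ : Fin k => γ) {s : Fin k → ℝ | ∑ i, s i ∈ A} := by
  rw [offspringSumLaw, Measure.sum_apply _ hA]
  refine tsum_congr fun k => ?_
  rw [Measure.smul_apply, Measure.map_apply (measurable_coordSum k) hA, smul_eq_mul]
  rfl

theorem isProbabilityMeasure_offspringSumLaw {α : ℝ} {γ : Measure ℝ}
    (hγ : IsRDEFixedPoint α γ) : IsProbabilityMeasure (offspringSumLaw α γ) := by
  obtain ⟨hprob, -, hfix⟩ := hγ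
  have := isProbabilityMeasure_unifMeasure
  constructor
  have hmass : rdeMap α γ Set.univ = 1 := by rw [hfix]; exact measure_univ
  rw [rdeMap, Measure.sum_apply _ MeasurableSet.univ] at hmass
  rw [offspringSumLaw_apply α γ MeasurableSet.univ, ← hmass]
  refine tsum_congr fun k => ?_
  rw [Measure.smul_apply, Measure.map_apply (measurable_rdeFun k) MeasurableSet.univ]
  simp

theorem ae_card_le_coordSum {γ : Measure ℝ} [IsProbabilityMeasure γ] (h1 : γ (Set.Iio 1) = 0)
    (k : ℕ) : ∀ᵐ s ∂(Measure.pi fun _ : Fin k => γ), (k : ℝ) ≤ ∑ i, s i := by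
  have hcoord : ∀ i : Fin k, ∀ᵐ s ∂(Measure.pi fun _ : Fin k => γ), 1 ≤ s i := by
    intro i
    have hone : ∀ᵐ x ∂γ, 1 ≤ x := by
      rw [ae_iff]
      simpa [Set.Iio] using h1
    exact (measurePreserving_eval (fun _ : Fin k => γ) i).quasiMeasurePreserving.ae hone
  filter_upwards [ae_all_iff.mpr hcoord] with s hs
  simpa using Finset.card_nsmul_le_sum Finset.univ s 1 fun i _ => hs i

theorem ae_two_le_offspringSumLaw {α : ℝ} {γ : Measure ℝ} (hγ : IsRDEFixedPoint α γ) :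
    ∀ᵐ s ∂offspringSumLaw α γ, 2 ≤ s := by
  obtain ⟨hprob, h1, -⟩ := hγ
  have hset : {s : ℝ | ¬ 2 ≤ s} = Set.Iio 2 := by ext; simp
  rw [ae_iff, hset, offspringSumLaw_apply α γ measurableSet_Iio, ENNReal.tsum_eq_zero]
  intro k
  by_cases hk : 2 ≤ k
  · refine mul_eq_zero_of_right _ (measure_mono_null ?_ (ae_iff.mp (ae_card_le_coordSum h1 k)))
    intro s hs
    have h2 : (2 : ℝ) ≤ k := by exact_mod_cast hk
    have hs2 : ∑ i, s i < 2 := hs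
    exact not_le.mpr (by linarith)
  · simp [thetaDist, hk]

theorem unifMeasure_le_inv {s t : ℝ} (hs : 2 ≤ s) (ht : t ∈ Set.Icc (1 : ℝ) 2) :
    unifMeasure {u : ℝ | t ≤ (u + (1 - u) / s)⁻¹} =
      ENNReal.ofReal (1 / t - (1 - 1 / t) * (s - 1)⁻¹) := by
  obtain ⟨ht1, ht2⟩ := ht
  have hs0 : 0 < s := by linarith
  have hs1 : 0 < s - 1 := by linarith
  have ht0 : 0 < t := by linarith
  have hmeas : MeasurableSet {u : ℝ | t ≤ (u + (1 - u) / s)⁻¹} :=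
    measurableSet_le measurable_const (by fun_prop)
  have hq : 1 / t - (1 - 1 / t) * (s - 1)⁻¹ = (s - t) / (t * (s - 1)) := by
    field_simp
    ring
  have hset : {u : ℝ | t ≤ (u + (1 - u) / s)⁻¹} ∩ Set.Icc 0 1 =
      Set.Icc 0 ((s - t) / (t * (s - 1))) := by
    ext u
    have hq1 : (s - t) / (t * (s - 1)) ≤ 1 := by
      rw [div_le_one (by positivity)]
      nlinarith
    have key : 0 ≤ u → u ≤ 1 →
        (t ≤ (u + (1 - u) / s)⁻¹ ↔ u ≤ (s - t) / (t * (s - 1))) := by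
      intro hu0 hu1
      have hw : 0 < u * s + (1 - u) := by nlinarith
      have hrew : (u + (1 - u) / s)⁻¹ = s / (u * s + (1 - u)) := by
        field_simp
      rw [hrew, le_div_iff₀ hw, le_div_iff₀ (by positivity)]
      constructor <;> intro h <;> nlinarith
    simp only [Set.mem_inter_iff, Set.mem_ofPred_eq, Set.mem_Icc]
    constructor
    · rintro ⟨h, h0, h1⟩
      exact ⟨h0, (key h0 h1).mp h⟩
    · rintro ⟨h0, h⟩
      exact ⟨(key h0 (h.trans hq1)).mpr h, h0, h.trans hq1⟩
  rw [unifMeasure, Measure.restrict_apply hmeas, hset, Real.volume_Icc, sub_zero, hq]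

theorem measure_Ici_eq_lintegral_offspringSumLaw {α : ℝ} {γ : Measure ℝ} (hγ : IsRDEFixedPoint α γ) {t : ℝ}
    (ht : t ∈ Set.Icc (1 : ℝ) 2) :
    γ (Set.Ici t) =
      ∫⁻ s, ENNReal.ofReal (1 / t - (1 - 1 / t) * (s - 1)⁻¹) ∂offspringSumLaw α γ := by
  have hprob := hγ.1
  have := isProbabilityMeasure_unifMeasure
  have hmeas : Measurable fun s : ℝ => unifMeasure {u : ℝ | t ≤ (u + (1 - u) / s)⁻¹} := by
    have hset : MeasurableSet {p : ℝ × ℝ | t ≤ (p.2 + (1 - p.2) / p.1)⁻¹} :=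
      measurableSet_le measurable_const (by fun_prop)
    exact measurable_measure_prodMk_left hset
  have hae := (ae_two_le_offspringSumLaw hγ).mono fun s hs => unifMeasure_le_inv hs ht
  rw [← lintegral_congr_ae hae, offspringSumLaw, lintegral_sum_measure]
  conv_lhs => rw [← hγ.2.2]
  rw [rdeMap, Measure.sum_apply _ measurableSet_Ici]
  refine tsum_congr fun k => ?_
  rw [lintegral_smul_measure, lintegral_map hmeas (measurable_coordSum k), Measure.smul_apply,
    Measure.map_apply (measurable_rdeFun k) measurableSet_Ici,
    Measure.prod_apply_symm (measurable_rdeFun k measurableSet_Ici)]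
  rfl

theorem tsum_thetaDist_mul_tail {α : ℝ} (hα : α ∈ Set.Ioc (1 : ℝ) 2) {γ : Measure ℝ}
    [IsProbabilityMeasure γ] (x : ℝ) :
    ∑' k : ℕ, thetaDist α k *
        ((Measure.pi fun _ : Fin k => γ) {s : Fin k → ℝ | x ≤ ∑ i, s i}).toReal =
      (offspringSumLaw α γ).real (Set.Ici x) := by
  rw [Measure.real, offspringSumLaw_apply α γ measurableSet_Ici, ENNReal.tsum_toReal_eq
    fun k => ENNReal.mul_ne_top ENNReal.ofReal_ne_top (measure_ne_top _ _)]
  refine tsum_congr fun k => ?_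
  rw [ENNReal.toReal_mul, ENNReal.toReal_ofReal (thetaDist_nonneg hα k)]
  rfl

theorem integral_inv_add_one_sq {a : ℝ} (ha : 0 ≤ a) :
    ∫ x in (0 : ℝ)..a, ((x + 1) ^ 2)⁻¹ = 1 - (a + 1)⁻¹ := by
  have hpos : ∀ x ∈ Set.uIcc 0 a, 0 < x + 1 := fun x hx => by
    rw [Set.uIcc_of_le ha] at hx
    linarith [hx.1]
  have hderiv : ∀ x ∈ Set.uIcc 0 a, HasDerivAt (fun x : ℝ => -(x + 1)⁻¹) ((x + 1) ^ 2)⁻¹ x := by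
    intro x hx
    have h := (((hasDerivAt_id x).add_const (1 : ℝ)).inv (hpos x hx).ne').neg
    rw [neg_div, neg_neg, one_div] at h
    exact h
  have hcont : ContinuousOn (fun x : ℝ => ((x + 1) ^ 2)⁻¹) (Set.uIcc 0 a) :=
    ContinuousOn.inv₀ (by fun_prop) fun x hx => (pow_pos (hpos x hx) 2).ne'
  rw [intervalIntegral.integral_eq_sub_of_hasDerivAt hderiv hcont.intervalIntegrable]
  norm_num
  ring

/-- Layer-cake formula for E[1 − 1/(S − 1)], where S ≥ 2 almost surely. -/
theorem integral_tail_div_sub_one_sq {ν : Measure ℝ} [IsProbabilityMeasure ν]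
    (hν : ∀ᵐ s ∂ν, 2 ≤ s) :
    ∫ x in Set.Ioi (2 : ℝ), ν.real (Set.Ici x) / (x - 1) ^ 2 = ∫ s, (1 - (s - 1)⁻¹) ∂ν := by
  have hshift := (measurePreserving_add_right volume (2 : ℝ)).setIntegral_preimage_emb
    (measurableEmbedding_addRight (2 : ℝ))
    (fun x : ℝ => ν.real (Set.Ici x) / (x - 1) ^ 2) (Set.Ioi 2)
  have hpre : (fun x : ℝ => x + 2) ⁻¹' Set.Ioi 2 = Set.Ioi 0 := by
    ext x
    simp
  rw [hpre] at hshift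
  have htail : Measurable fun x : ℝ => ν.real (Set.Ici (x + 2)) := by
    refine Antitone.measurable fun x y hxy => measureReal_mono ?_
    exact Set.Ici_subset_Ici.mpr (by linarith)
  have hcake := lintegral_comp_eq_lintegral_meas_le_mul (f := fun s : ℝ => s - 2)
    (g := fun x : ℝ => ((x + 1) ^ 2)⁻¹) ν
    (hν.mono fun s hs => sub_nonneg.mpr hs) (by fun_prop)
    (fun t ht => by
      refine ContinuousOn.intervalIntegrable
        (ContinuousOn.inv₀ (by fun_prop) fun x hx => ?_)
      rw [Set.uIcc_of_le (le_of_lt ht)] at hx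
      have : 0 < x + 1 := by linarith [hx.1]
      positivity)
    (Filter.Eventually.of_forall fun x => by positivity)
  rw [← hshift, integral_eq_lintegral_of_nonneg_ae
      (Filter.Eventually.of_forall fun x => by positivity)
      (by exact (htail.div (by fun_prop)).aestronglyMeasurable),
    integral_eq_lintegral_of_nonneg_ae
      (hν.mono fun s hs => sub_nonneg.mpr (inv_le_one_of_one_le₀ (by linarith))) (by fun_prop)]
  congr 1
  refine Eq.trans ?_ (hcake.symm.trans ?_)
  · refine lintegral_congr fun x => ?_
    have hset : {a : ℝ | x ≤ a - 2} = Set.Ici (x + 2) := by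
      ext a
      simp [le_sub_iff_add_le]
    rw [hset, div_eq_mul_inv, ENNReal.ofReal_mul measureReal_nonneg, ofReal_measureReal]
    congr 4
    ring
  · refine lintegral_congr_ae (hν.mono fun s hs => ?_)
    simp only
    rw [integral_inv_add_one_sq (sub_nonneg.mpr hs)]
    congr 3
    ring

/-- For a fixed point γ of the α-RDE, there exists D ∈ [1,2] such that
γ([t,∞)) = D/t + 1 − D for every t ∈ [1,2], and
D = 2 − ∫₂^∞ (Σ_k θ_α(k) F^{(k)}(x))·(x−1)^{−2} dx. -/
theorem tail_on_one_two (α : ℝ) (hα : α ∈ Set.Ioc (1 : ℝ) 2)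
    (γ : Measure ℝ) (hγ : IsRDEFixedPoint α γ) :
    ∃ D ∈ Set.Icc (1 : ℝ) 2,
      (∀ t ∈ Set.Icc (1 : ℝ) 2, (γ (Set.Ici t)).toReal = D / t + 1 - D) ∧
      D = 2 - ∫ x in Set.Ioi (2 : ℝ),
          (∑' k : ℕ, thetaDist α k *
              ((Measure.pi fun _ : Fin k => γ) {s : Fin k → ℝ | x ≤ ∑ i, s i}).toReal)
            / (x - 1) ^ 2 := by
  have hprob := hγ.1
  have hνprob := isProbabilityMeasure_offspringSumLaw hγ
  have hν := ae_two_le_offspringSumLaw hγ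
  have hbound : ∀ᵐ s ∂offspringSumLaw α γ, (s - 1)⁻¹ ∈ Set.Icc (0 : ℝ) 1 :=
    hν.mono fun s hs =>
      ⟨inv_nonneg.mpr (by linarith), inv_le_one_of_one_le₀ (by linarith)⟩
  have hint : Integrable (fun s : ℝ => (s - 1)⁻¹) (offspringSumLaw α γ) :=
    Integrable.of_mem_Icc 0 1 (by fun_prop) hbound
  refine ⟨1 + ∫ s, (s - 1)⁻¹ ∂offspringSumLaw α γ, ⟨?_, ?_⟩, fun t ht => ?_, ?_⟩
  · linarith [integral_nonneg_of_ae (hbound.mono fun s hs => hs.1)]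
  · have hle := integral_mono_ae hint (integrable_const (1 : ℝ)) (hbound.mono fun s hs => hs.2)
    rw [integral_const, probReal_univ, one_smul] at hle
    linarith
  · have ht0 : 0 < t := by linarith [ht.1]
    have hnonneg : ∀ᵐ s ∂offspringSumLaw α γ, 0 ≤ 1 / t - (1 - 1 / t) * (s - 1)⁻¹ := by
      filter_upwards [hbound] with s hs
      have h1 : 1 / t ≤ 1 := (div_le_one ht0).mpr ht.1
      have h2 : 1 / 2 ≤ 1 / t := one_div_le_one_div_of_le ht0 ht.2
      nlinarith [hs.1, hs.2]
    rw [measure_Ici_eq_lintegral_offspringSumLaw hγ ht,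
      ← integral_eq_lintegral_of_nonneg_ae hnonneg (by fun_prop),
      integral_sub (integrable_const _) (hint.const_mul _), integral_const_mul, integral_const,
      probReal_univ, one_smul]
    ring
  · simp_rw [tsum_thetaDist_mul_tail hα]
    rw [integral_tail_div_sub_one_sq hν, integral_sub (integrable_const _) hint, integral_const,
      probReal_univ, one_smul]
    ring
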